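/- arXiv:2201.00852 — 3 statements merged into one kernel-verified Lean document; each statement's English description precedes it below -/
import Mathlib

section
/- Let X and Y be nonempty sets, let 𝔍 : (X×Y)×(X×Y) → ℝ be a symmetric kernel, and fix x₀ ∈ X, y₀ ∈ Y. Define K^𝔍((x,y),(x',y')) := ∑_{i,j,k,l ∈ {0,1}} (−1)^{i+j+k+l} 𝔍((u_i, v_j),(u'_k, v'_l)), where u_0 = x, u_1 = x₀, v_0 = y, v_1 = y₀, u'_0 = x', u'_1 = x₀, v'_0 = y', v'_1 = y₀ (the 16-term alternating sum obtained by substituting x₀ for x or x', and y₀ for y or y', in all possible ways). Then K^𝔍 is positive definite if and only if 𝔍 is positive definite independent. -/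
open Finset

/-- A symmetric kernel `K : Z × Z → ℝ` is positive definite (PD) if all its quadratic
forms on finitely many points are nonnegative. -/
def IsPD {Z : Type*} (K : Z → Z → ℝ) : Prop :=
  ∀ (n : ℕ) (z : Fin n → Z) (c : Fin n → ℝ),
    0 ≤ ∑ i, ∑ j, c i * c j * K (z i) (z j)

/-- A symmetric kernel `𝔍 : (X × Y) × (X × Y) → ℝ` is positive definite independent (PDI). -/
def IsPDI {X Y : Type*} (J : X × Y → X × Y → ℝ) : Prop :=
  ∀ (n m : ℕ) (x : Fin n → X) (y : Fin m → Y) (c : Fin n → Fin m → ℝ),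
    (∀ k, ∑ i, c i k = 0) → (∀ i, ∑ k, c i k = 0) →
    0 ≤ ∑ i, ∑ j, ∑ k, ∑ l, c i k * c j l * J (x i, y k) (x j, y l)

/-- The mixed difference of `f` between `p` and the base point `(x₀, y₀)`. -/
def mixedDiff {X Y : Type*} (x₀ : X) (y₀ : Y) (f : X × Y → ℝ) (p : X × Y) : ℝ :=
  f (p.1, p.2) - f (x₀, p.2) - f (p.1, y₀) + f (x₀, y₀)

theorem sum_mul_mixedDiff_comm {X Y ι : Type*} [Fintype ι] (x₀ : X) (y₀ : Y) (c : ι → ℝ)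
    (h : X × Y → ι → ℝ) (p : X × Y) :
    ∑ i, c i * mixedDiff x₀ y₀ (fun q => h q i) p
      = mixedDiff x₀ y₀ (fun q => ∑ i, c i * h q i) p := by
  simp only [mixedDiff, mul_add, mul_sub, sum_add_distrib, sum_sub_distrib]

/-- Iterating mixed differences in both arguments of a kernel gives a quadratic form that is
the composition of two linear functionals. -/
theorem sum_mul_sum_mul_mixedDiff {X Y ι : Type*} [Fintype ι] (x₀ : X) (y₀ : Y)
    (J : X × Y → X × Y → ℝ) (c : ι → ℝ) (z : ι → X × Y) :
    ∑ i, c i * ∑ j, c j * mixedDiff x₀ y₀ (fun p => mixedDiff x₀ y₀ (J p) (z j)) (z i)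
      = ∑ i, c i * mixedDiff x₀ y₀
          (fun p => ∑ j, c j * mixedDiff x₀ y₀ (J p) (z j)) (z i) := by
  simp only [sum_mul_mixedDiff_comm x₀ y₀ c (fun p j => mixedDiff x₀ y₀ (J p) (z j))]

theorem sum_mul_mixedDiff_of_marginals_eq_zero {X Y ι κ : Type*} [Fintype ι] [Fintype κ]
    (x₀ : X) (y₀ : Y) (x : ι → X) (y : κ → Y) (c : ι → κ → ℝ)
    (hcol : ∀ k, ∑ i, c i k = 0) (hrow : ∀ i, ∑ k, c i k = 0) (f : X × Y → ℝ) :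
    ∑ s : ι × κ, c s.1 s.2 * mixedDiff x₀ y₀ f (x s.1, y s.2)
      = ∑ i, ∑ k, c i k * f (x i, y k) := by
  have hx : ∑ i, ∑ k, c i k * f (x₀, y k) = 0 := by
    rw [sum_comm]
    simp only [← sum_mul, hcol, zero_mul, sum_const_zero]
  have hy : ∑ i, ∑ k, c i k * f (x i, y₀) = 0 := by
    simp only [← sum_mul, hrow, zero_mul, sum_const_zero]
  have hxy : ∑ i, ∑ k, c i k * f (x₀, y₀) = 0 := by
    simp only [← sum_mul, hrow, zero_mul, sum_const_zero]
  rw [Fintype.sum_prod_type]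
  simp only [mixedDiff, mul_add, mul_sub, sum_add_distrib, sum_sub_distrib, hx, hy, hxy]
  ring

theorem IsPD.sum_nonneg {Z ι : Type*} [Fintype ι] {K : Z → Z → ℝ} (hK : IsPD K)
    (z : ι → Z) (c : ι → ℝ) : 0 ≤ ∑ i, c i * ∑ j, c j * K (z i) (z j) := by
  let e := (Fintype.equivFin ι).symm
  have h := hK _ (z ∘ e) (c ∘ e)
  simp only [mul_assoc, ← mul_sum, Function.comp_apply] at h
  simpa only [fun a => e.sum_comp (fun j => c j * K a (z j)),
    e.sum_comp (fun i => c i * ∑ j, c j * K (z i) (z j))] using h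

theorem sum_mul_mul_eq_sum_mul_sum {X Y ι κ : Type*} [Fintype ι] [Fintype κ]
    (J : X × Y → X × Y → ℝ) (x : ι → X) (y : κ → Y) (c : ι → κ → ℝ) :
    ∑ i, ∑ j, ∑ k, ∑ l, c i k * c j l * J (x i, y k) (x j, y l)
      = ∑ i, ∑ k, c i k * ∑ j, ∑ l, c j l * J (x i, y k) (x j, y l) := by
  refine sum_congr rfl fun i _ => ?_
  rw [sum_comm]
  simp only [mul_assoc, mul_sum]

theorem IsPDI.sum_nonneg {X Y ι κ : Type*} [Fintype ι] [Fintype κ] {J : X × Y → X × Y → ℝ}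
    (hJ : IsPDI J) (x : ι → X) (y : κ → Y) (c : ι → κ → ℝ)
    (hcol : ∀ k, ∑ i, c i k = 0) (hrow : ∀ i, ∑ k, c i k = 0) :
    0 ≤ ∑ i, ∑ k, c i k * ∑ j, ∑ l, c j l * J (x i, y k) (x j, y l) := by
  let e := (Fintype.equivFin ι).symm
  let d := (Fintype.equivFin κ).symm
  have reindex (f : ι → κ → ℝ) : ∑ i, ∑ k, f (e i) (d k) = ∑ i, ∑ k, f i k := by
    rw [← e.sum_comp]
    exact sum_congr rfl fun i _ => d.sum_comp (f (e i))
  have h := hJ _ _ (x ∘ e) (y ∘ d) (fun i k => c (e i) (d k))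
    (fun k => (e.sum_comp (fun i => c i (d k))).trans (hcol _))
    (fun i => (d.sum_comp (c (e i))).trans (hrow _))
  rw [sum_mul_mul_eq_sum_mul_sum] at h
  simp only [Function.comp_apply] at h
  simpa only [fun p => reindex (fun j l => c j l * J p (x j, y l)),
    reindex (fun i k => c i k * ∑ j, ∑ l, c j l * J (x i, y k) (x j, y l))] using h

/-- The diagonal coefficients `c`, completed by an extra row and an extra column so that
all row and column sums vanish. -/
def completedDiagonal {ι : Type*} [Fintype ι] [DecidableEq ι] (c : ι → ℝ) :
    Option ι → Option ι → ℝ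
  | some i, some k => if i = k then c i else 0
  | none, some k => -c k
  | some i, none => -c i
  | none, none => ∑ i, c i

theorem sum_completedDiagonal_left {ι : Type*} [Fintype ι] [DecidableEq ι] (c : ι → ℝ)
    (k : Option ι) : ∑ i, completedDiagonal c i k = 0 := by
  cases k <;> simp [Fintype.sum_option, completedDiagonal]

theorem sum_completedDiagonal_right {ι : Type*} [Fintype ι] [DecidableEq ι] (c : ι → ℝ)
    (i : Option ι) : ∑ k, completedDiagonal c i k = 0 := by
  cases i <;> simp [Fintype.sum_option, completedDiagonal]

theorem sum_completedDiagonal_mul {X Y ι : Type*} [Fintype ι] [DecidableEq ι]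
    (x₀ : X) (y₀ : Y) (c : ι → ℝ) (z : ι → X × Y) (f : X × Y → ℝ) :
    ∑ i, ∑ k, completedDiagonal c i k *
        f (i.elim x₀ fun a => (z a).1, k.elim y₀ fun a => (z a).2)
      = ∑ i, c i * mixedDiff x₀ y₀ f (z i) := by
  simp only [Fintype.sum_option, completedDiagonal, Option.elim, mixedDiff, mul_add, mul_sub,
    sum_add_distrib, sum_sub_distrib, ite_mul, zero_mul, sum_ite_eq, mem_univ, if_true,
    neg_mul, sum_neg_distrib, sum_mul]
  ring

theorem isPD_mixedDiff_iff_isPDI {X Y : Type*} (J : X × Y → X × Y → ℝ) (x₀ : X) (y₀ : Y) :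
    IsPD (fun p q => mixedDiff x₀ y₀ (fun p' => mixedDiff x₀ y₀ (J p') q) p) ↔ IsPDI J := by
  constructor
  · intro hK n m x y c hcol hrow
    have h := hK.sum_nonneg (fun s : Fin n × Fin m => (x s.1, y s.2)) (fun s => c s.1 s.2)
    rw [sum_mul_sum_mul_mixedDiff] at h
    simp only [sum_mul_mixedDiff_of_marginals_eq_zero x₀ y₀ x y c hcol hrow] at h
    rwa [sum_mul_mul_eq_sum_mul_sum]
  · intro hJ n z c
    have h := hJ.sum_nonneg (fun i : Option (Fin n) => i.elim x₀ fun a => (z a).1)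
      (fun k : Option (Fin n) => k.elim y₀ fun a => (z a).2) (completedDiagonal c)
      (sum_completedDiagonal_left c) (sum_completedDiagonal_right c)
    simp only [sum_completedDiagonal_mul x₀ y₀ c z (J _)] at h
    rw [sum_completedDiagonal_mul x₀ y₀ c z
      (fun p => ∑ j, c j * mixedDiff x₀ y₀ (J p) (z j)), ← sum_mul_sum_mul_mixedDiff] at h
    simpa only [mul_assoc, ← mul_sum] using h

/-- the 16-term alternating-sum kernel `K^𝔍` built from a symmetric kernel `𝔍`
and base points `x₀, y₀` is positive definite iff `𝔍` is positive definite independent. -/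
theorem stmt0 {X Y : Type*} [Nonempty X] [Nonempty Y]
    (J : X × Y → X × Y → ℝ) (hsym : ∀ p q, J p q = J q p) (x₀ : X) (y₀ : Y) :
    IsPD (fun p q : X × Y =>
      J (p.1, p.2) (q.1, q.2) - J (x₀, p.2) (q.1, q.2)
        - J (p.1, y₀) (q.1, q.2) + J (x₀, y₀) (q.1, q.2)
      - J (p.1, p.2) (x₀, q.2) + J (x₀, p.2) (x₀, q.2)
        + J (p.1, y₀) (x₀, q.2) - J (x₀, y₀) (x₀, q.2)
      - J (p.1, p.2) (q.1, y₀) + J (x₀, p.2) (q.1, y₀)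
        + J (p.1, y₀) (q.1, y₀) - J (x₀, y₀) (q.1, y₀)
      + J (p.1, p.2) (x₀, y₀) - J (x₀, p.2) (x₀, y₀)
        - J (p.1, y₀) (x₀, y₀) + J (x₀, y₀) (x₀, y₀))
    ↔ IsPDI J := by
  rw [← isPD_mixedDiff_iff_isPDI J x₀ y₀]
  refine iff_of_eq (congrArg IsPD ?_)
  funext p q
  simp only [mixedDiff]
  ring
end

section
/- Let X and Y be nonempty sets and 𝔍 : (X×Y)×(X×Y) → ℝ a symmetric kernel. Define 𝔍'((x,y),(x',y')) := 𝔍((x,y),(x',y')) − ½𝔍((x,y),(x,y')) − ½𝔍((x',y),(x',y')) − ½𝔍((x,y),(x',y)) − ½𝔍((x,y'),(x',y')) + ¼𝔍((x,y),(x,y)) + ¼𝔍((x,y'),(x,y')) + ¼𝔍((x',y),(x',y)) + ¼𝔍((x',y'),(x',y')). Then 𝔍' is positive definite independent if and only if 𝔍 is positive definite independent. -/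
open Finset

/-- Against coefficients whose row and column sums vanish, the quadratic form of a kernel is
unchanged by adding terms that do not depend on one of the four indices. -/
theorem sum_mul_add_eq_of_marginals_zero {ι κ : Type*} [Fintype ι] [Fintype κ]
    (c : ι → κ → ℝ) (hcol : ∀ k, ∑ i, c i k = 0) (hrow : ∀ i, ∑ k, c i k = 0)
    (F : ι → ι → κ → κ → ℝ) (f g : ι → κ → κ → ℝ) (u v : ι → ι → κ → ℝ) :
    ∑ i, ∑ j, ∑ k, ∑ l, c i k * c j l * (F i j k l + f i k l + g j k l + u i j k + v i j l) =
      ∑ i, ∑ j, ∑ k, ∑ l, c i k * c j l * F i j k l := by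
  have hf : ∑ i, ∑ j, ∑ k, ∑ l, c i k * c j l * f i k l = 0 := by
    refine sum_eq_zero fun i _ => ?_
    rw [sum_comm]
    refine sum_eq_zero fun k _ => ?_
    rw [sum_comm]
    refine sum_eq_zero fun l _ => ?_
    rw [← sum_mul, ← mul_sum, hcol, mul_zero, zero_mul]
  have hg : ∑ i, ∑ j, ∑ k, ∑ l, c i k * c j l * g j k l = 0 := by
    rw [sum_comm]
    refine sum_eq_zero fun j _ => ?_
    rw [sum_comm]
    refine sum_eq_zero fun k _ => ?_
    rw [sum_comm]
    refine sum_eq_zero fun l _ => ?_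
    rw [← sum_mul, ← sum_mul, hcol, zero_mul, zero_mul]
  have hu : ∑ i, ∑ j, ∑ k, ∑ l, c i k * c j l * u i j k = 0 := by
    refine sum_eq_zero fun i _ => sum_eq_zero fun j _ => sum_eq_zero fun k _ => ?_
    rw [← sum_mul, ← mul_sum, hrow, mul_zero, zero_mul]
  have hv : ∑ i, ∑ j, ∑ k, ∑ l, c i k * c j l * v i j l = 0 := by
    refine sum_eq_zero fun i _ => sum_eq_zero fun j _ => ?_
    rw [sum_comm]
    refine sum_eq_zero fun l _ => ?_
    rw [← sum_mul, ← sum_mul, hrow, zero_mul, zero_mul]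
  simp only [mul_add, sum_add_distrib, hf, hg, hu, hv, add_zero]

/-- the modified kernel `𝔍'` is PDI iff `𝔍` is PDI. -/
theorem stmt1 {X Y : Type*} [Nonempty X] [Nonempty Y]
    (J : X × Y → X × Y → ℝ) (hsym : ∀ p q, J p q = J q p) :
    IsPDI (fun p q : X × Y =>
      J (p.1, p.2) (q.1, q.2)
        - J (p.1, p.2) (p.1, q.2) / 2 - J (q.1, p.2) (q.1, q.2) / 2
        - J (p.1, p.2) (q.1, p.2) / 2 - J (p.1, q.2) (q.1, q.2) / 2
        + J (p.1, p.2) (p.1, p.2) / 4 + J (p.1, q.2) (p.1, q.2) / 4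
        + J (q.1, p.2) (q.1, p.2) / 4 + J (q.1, q.2) (q.1, q.2) / 4)
    ↔ IsPDI J := by
  unfold IsPDI
  refine forall_congr' fun n => forall_congr' fun m => forall_congr' fun x =>
    forall_congr' fun y => forall_congr' fun c => forall_congr' fun hcol =>
    forall_congr' fun hrow => ?_
  rw [← sum_mul_add_eq_of_marginals_zero c hcol hrow
    (fun i j k l => J (x i, y k) (x j, y l))
    (fun i k l => -J (x i, y k) (x i, y l) / 2 + J (x i, y k) (x i, y k) / 4
      + J (x i, y l) (x i, y l) / 4)
    (fun j k l => -J (x j, y k) (x j, y l) / 2 + J (x j, y k) (x j, y k) / 4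
      + J (x j, y l) (x j, y l) / 4)
    (fun i j k => -J (x i, y k) (x j, y k) / 2)
    (fun i j l => -J (x i, y l) (x j, y l) / 2)]
  refine iff_of_eq (congrArg (0 ≤ ·) ?_)
  refine sum_congr rfl fun i _ => sum_congr rfl fun j _ => sum_congr rfl fun k _ =>
    sum_congr rfl fun l _ => ?_
  ring
end

section
/- Let X be a nonempty set and f : X×X×[0,∞) → ℝ be such that f(u,v,·) is continuous on [0,∞) for every u,v ∈ X. The kernel ((u,x),(v,y)) ↦ f(u,v,‖x−y‖) on (X×ℝ^d)×(X×ℝ^d) is positive definite independent for every d ∈ ℕ with zero projection kernels if and only if f can be represented as f(u,v,t) = ∫_{[0,∞)} (1−e^{−r t²})(1+r)/r dσ_{u,v}(r) for all t ≥ 0, where each σ_{u,v} is a finite Radon measure on [0,∞), for every Borel set A ⊂ [0,∞) the kernel (u,v) ↦ σ_{u,v}(A) is conditionally negative definite on X, and σ_{u,u} is the zero measure for every u ∈ X. Moreover, this representation is unique. -/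
open MeasureTheory Set Finset

noncomputable section

/-- A symmetric kernel `γ : X × X → ℝ` is conditionally negative definite (CND). -/
def IsCND {X : Type*} (γ : X → X → ℝ) : Prop :=
  ∀ (n : ℕ) (x : Fin n → X) (c : Fin n → ℝ), (∑ i, c i) = 0 →
    ∑ i, ∑ j, c i * c j * γ (x i) (x j) ≤ 0

/-- The integrand `(1 - e^{-r t²})(1 + r)/r`, whose value at `r = 0` is its limit `t²`. -/
def G8 (r : NNReal) (t : ℝ) : ℝ :=
  if r = 0 then t ^ 2 else (1 - Real.exp (-(r : ℝ) * t ^ 2)) * (1 + (r : ℝ)) / (r : ℝ)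

section Auxiliary

open Polynomial Filter Topology

lemma cast_descFactorial_succ_mul (k j : ℕ) :
    ((k.descFactorial (j + 1) : ℕ) : ℝ) = ((k : ℝ) - j) * (k.descFactorial j : ℕ) := by
  rw [Nat.descFactorial_succ]
  rcases lt_or_ge k j with h | h
  · simp [Nat.descFactorial_eq_zero_iff_lt.2 h]
  · push_cast [Nat.cast_sub h]; ring

lemma abs_descFactorial_div_sub_pow_le {n j k : ℕ} (hj : j < n) (hk : k ≤ n) :
    |((k.descFactorial j : ℕ) : ℝ) / (n.descFactorial j : ℕ) - ((k : ℝ) / n) ^ j|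
      ≤ (j : ℝ) ^ 2 / (n - j) := by
  induction j with
  | zero => simp
  | succ j ih =>
    have hjn : (j : ℝ) + 1 < n := by exact_mod_cast hj
    have hn : (0 : ℝ) < n := by have : (0:ℝ) ≤ j := j.cast_nonneg; linarith
    have hkn : (k : ℝ) ≤ n := by exact_mod_cast hk
    have ih := ih (by omega)
    have hj0 : (0 : ℝ) ≤ j := j.cast_nonneg
    have hd : (0 : ℝ) < (n.descFactorial j : ℕ) := by
      exact_mod_cast Nat.descFactorial_pos.2 (by omega)
    have hp0 : (0 : ℝ) ≤ ((k.descFactorial j : ℕ) : ℝ) / (n.descFactorial j : ℕ) := by positivity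
    have hp1 : ((k.descFactorial j : ℕ) : ℝ) / (n.descFactorial j : ℕ) ≤ 1 := by
      rw [div_le_one hd]
      exact_mod_cast Nat.descFactorial_le j hk
    rw [cast_descFactorial_succ_mul, cast_descFactorial_succ_mul, mul_div_mul_comm]
    set p := ((k.descFactorial j : ℕ) : ℝ) / (n.descFactorial j : ℕ)
    have hq0 : (0 : ℝ) ≤ k / n := by positivity
    have hq1 : (k : ℝ) / n ≤ 1 := by rw [div_le_one hn]; exact hkn
    have e1 : ((k : ℝ) - j) / (n - j) * p - (k / n) ^ (j + 1)
        = p * (((k : ℝ) - j) / (n - j) - k / n) + k / n * (p - (k / n) ^ j) := by ring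
    have e2 : |((k : ℝ) - j) / (n - j) - k / n| ≤ j / (n - j) := by
      have : ((k : ℝ) - j) / (n - j) - k / n = - (j / (n - j) * (1 - k / n)) := by
        have : (n : ℝ) - j ≠ 0 := by linarith
        field_simp
        ring
      rw [this, abs_neg, abs_of_nonneg]
      · apply mul_le_of_le_one_right
        · apply div_nonneg hj0; linarith
        · linarith
      · apply mul_nonneg
        · apply div_nonneg hj0; linarith
        · linarith
    rw [e1]
    calc _ ≤ |p * (((k : ℝ) - j) / (n - j) - k / n)| + |k / n * (p - (k / n) ^ j)| :=
          abs_add_le _ _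
      _ ≤ j / (n - j) + (j : ℝ) ^ 2 / (n - j) := by
          rw [abs_mul, abs_mul, abs_of_nonneg hp0, abs_of_nonneg hq0]
          gcongr
          · exact (mul_le_of_le_one_left (abs_nonneg _) hp1).trans e2
          · exact (mul_le_of_le_one_left (abs_nonneg _) hq1).trans ih
      _ ≤ _ := by
          rw [← add_div]
          push_cast
          have : (0 : ℝ) < n - (j + 1) := by linarith
          gcongr
          · nlinarith
          · linarith

lemma sum_descFactorial_smul_bernsteinPolynomial (n j : ℕ) (hj : j ≤ n) :
    ∑ k ∈ range (n + 1), ((k.descFactorial j : ℕ) : ℝ) • bernsteinPolynomial ℝ n k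
      = ((n.descFactorial j : ℕ) : ℝ) • (X : ℝ[X]) ^ j := by
  obtain ⟨m, rfl⟩ := Nat.exists_eq_add_of_le hj
  rw [add_assoc, Finset.sum_range_add]
  have h0 : ∑ k ∈ range j, ((k.descFactorial j : ℕ) : ℝ) • bernsteinPolynomial ℝ (j + m) k = 0 := by
    apply Finset.sum_eq_zero
    intro k hk
    rw [Nat.descFactorial_eq_zero_iff_lt.2 (Finset.mem_range.1 hk)]
    simp
  rw [h0, zero_add]
  have h1 : (X : ℝ[X]) ^ j = X ^ j * (X + (1 - X)) ^ m := by simp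
  rw [h1, add_pow, Finset.mul_sum, Finset.smul_sum]
  apply Finset.sum_congr rfl
  intro i hi
  have hi' : i ≤ m := by simpa [Nat.lt_succ_iff] using hi
  have key : (j + i).descFactorial j * (j + m).choose (j + i)
      = (j + m).descFactorial j * m.choose i := by
    rw [Nat.descFactorial_eq_factorial_mul_choose, Nat.descFactorial_eq_factorial_mul_choose,
      mul_assoc, mul_assoc, mul_comm ((j + i).choose j), Nat.choose_mul (by omega)]
    simp
  have key' : (((j + i).descFactorial j : ℕ) : ℝ[X]) * ((j + m).choose (j + i) : ℕ)
      = (((j + m).descFactorial j : ℕ) : ℝ[X]) * (m.choose i : ℕ) := by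
    exact_mod_cast congrArg (Nat.cast : ℕ → ℝ[X]) key
  rw [bernsteinPolynomial, Nat.add_sub_add_left, ← Polynomial.C_mul', ← Polynomial.C_mul']
  simp only [map_natCast]
  rw [pow_add]
  linear_combination (X ^ j * X ^ i * (1 - X) ^ (m - i)) * key'

/-- A linear functional on polynomials that is nonnegative on `X ^ k * (1 - X) ^ j` is nonnegative
on the Bernstein polynomials. -/
lemma bernsteinPolynomial_functional_nonneg (L : ℝ[X] →ₗ[ℝ] ℝ)
    (hL : ∀ k j : ℕ, 0 ≤ L (X ^ k * (1 - X) ^ j)) (n k : ℕ) :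
    0 ≤ L (bernsteinPolynomial ℝ n k) := by
  have : bernsteinPolynomial ℝ n k = ((n.choose k : ℕ) : ℝ) • (X ^ k * (1 - X) ^ (n - k)) := by
    rw [bernsteinPolynomial, ← Polynomial.C_mul']
    simp [mul_assoc]
  rw [this, map_smul]
  exact mul_nonneg (Nat.cast_nonneg _) (hL _ _)

lemma tendsto_bernstein_moment (L : ℝ[X] →ₗ[ℝ] ℝ)
    (hL : ∀ k j : ℕ, 0 ≤ L (X ^ k * (1 - X) ^ j)) (j : ℕ) :
    Tendsto (fun n : ℕ => ∑ k ∈ range (n + 1), ((k : ℝ) / n) ^ j * L (bernsteinPolynomial ℝ n k))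
      atTop (𝓝 (L (X ^ j))) := by
  have hlim : Tendsto (fun n : ℕ => (j : ℝ) ^ 2 / (n - j) * L 1) atTop (𝓝 0) := by
    rw [← zero_mul (L 1)]
    apply Tendsto.mul_const
    apply Tendsto.const_div_atTop
    exact tendsto_atTop_add_const_right _ (-(j : ℝ)) tendsto_natCast_atTop_atTop
  rw [tendsto_iff_dist_tendsto_zero]
  refine squeeze_zero' (Eventually.of_forall fun _ => dist_nonneg) ?_ hlim
  filter_upwards [eventually_gt_atTop j] with n hn
  have hd : (0 : ℝ) < (n.descFactorial j : ℕ) := by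
    exact_mod_cast Nat.descFactorial_pos.2 hn.le
  have h1 : L (X ^ j) = ∑ k ∈ range (n + 1),
      ((k.descFactorial j : ℕ) : ℝ) / (n.descFactorial j : ℕ) * L (bernsteinPolynomial ℝ n k) := by
    have := congrArg L (sum_descFactorial_smul_bernsteinPolynomial n j hn.le)
    simp only [map_sum, map_smul, smul_eq_mul] at this
    rw [eq_comm, mul_comm, ← eq_div_iff hd.ne'] at this
    rw [this, Finset.sum_div]
    exact Finset.sum_congr rfl fun k _ => by ring
  have h2 : L 1 = ∑ k ∈ range (n + 1), L (bernsteinPolynomial ℝ n k) := by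
    rw [← map_sum, bernsteinPolynomial.sum]
  rw [dist_comm, Real.dist_eq, h1, ← Finset.sum_sub_distrib, h2, Finset.mul_sum]
  refine (Finset.abs_sum_le_sum_abs _ _).trans (Finset.sum_le_sum fun k hk => ?_)
  rw [← sub_mul, abs_mul, abs_of_nonneg (bernsteinPolynomial_functional_nonneg L hL n k)]
  gcongr
  · exact bernsteinPolynomial_functional_nonneg L hL n k
  · exact abs_descFactorial_div_sub_pow_le hn (by simpa [Nat.lt_succ_iff] using hk)

/-- Existence in the Hausdorff moment problem, for probability measures. -/
lemma exists_probabilityMeasure_moments (L : ℝ[X] →ₗ[ℝ] ℝ)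
    (hL : ∀ k j : ℕ, 0 ≤ L (X ^ k * (1 - X) ^ j)) (h1 : L 1 = 1) :
    ∃ μ : ProbabilityMeasure unitInterval, ∀ k : ℕ,
      ∫ x : unitInterval, (x : ℝ) ^ k ∂(μ : Measure unitInterval) = L (X ^ k) := by
  let M : ℕ → Measure unitInterval := fun n => ∑ k : Fin (n + 1),
    ENNReal.ofReal (L (bernsteinPolynomial ℝ n k)) • Measure.dirac (bernstein.z k)
  have hM : ∀ n, IsProbabilityMeasure (M n) := by
    intro n
    constructor
    simp only [M, Measure.coe_finsetSum, Finset.sum_apply, Measure.smul_apply, measure_univ,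
      smul_eq_mul, mul_one]
    rw [Fin.sum_univ_eq_sum_range (fun k => ENNReal.ofReal (L (bernsteinPolynomial ℝ n k))),
      ← ENNReal.ofReal_sum_of_nonneg
        fun k _ => bernsteinPolynomial_functional_nonneg L hL n k,
      ← map_sum, bernsteinPolynomial.sum, h1, ENNReal.ofReal_one]
  let P : ℕ → ProbabilityMeasure unitInterval := fun n => ⟨M n, hM n⟩
  obtain ⟨μ, -, hμ⟩ := isCompact_univ.ultrafilter_le_nhds ((hyperfilter ℕ).map P) (by simp)
  refine ⟨μ, fun j => ?_⟩
  have hμ' : Tendsto P (hyperfilter ℕ) (𝓝 μ) := hμ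
  rw [ProbabilityMeasure.tendsto_iff_forall_integral_tendsto] at hμ'
  have t1 := hμ' (BoundedContinuousFunction.mkOfCompact
    ⟨fun x : unitInterval => (x : ℝ) ^ j, by fun_prop⟩)
  have t2 := (tendsto_bernstein_moment L hL j).mono_left Nat.hyperfilter_le_atTop
  refine tendsto_nhds_unique t1 (t2.congr fun n => ?_)
  simp only [P, M, ProbabilityMeasure.coe_mk]
  rw [integral_finsetSum_measure]
  · simp only [integral_smul_measure, integral_dirac]
    rw [← Fin.sum_univ_eq_sum_range
      (fun k => ((k : ℝ) / n) ^ j * L (bernsteinPolynomial ℝ n k))]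
    refine Finset.sum_congr rfl fun k _ => ?_
    rw [ENNReal.toReal_ofReal (bernsteinPolynomial_functional_nonneg L hL n k)]
    simp [bernstein.z, mul_comm]
  · intro k _
    exact (integrable_dirac (by simp)).smul_measure (by simp)

/-- Existence in the **Hausdorff moment problem**. -/
lemma exists_measure_moments (L : ℝ[X] →ₗ[ℝ] ℝ)
    (hL : ∀ k j : ℕ, 0 ≤ L (X ^ k * (1 - X) ^ j)) :
    ∃ μ : Measure unitInterval, IsFiniteMeasure μ ∧
      ∀ k : ℕ, ∫ x : unitInterval, (x : ℝ) ^ k ∂μ = L (X ^ k) := by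
  have h0 : 0 ≤ L 1 := by simpa using hL 0 0
  rcases h0.eq_or_lt with h0 | h0
  · refine ⟨0, inferInstance, fun k => ?_⟩
    have ha : 0 ≤ L (X ^ k) := by simpa using hL k 0
    have hb : L (X ^ k) ≤ L 1 := by
      induction k with
      | zero => simp
      | succ k ih =>
        have h := hL k 1
        rw [pow_one, mul_sub, mul_one, ← pow_succ, map_sub] at h
        have := ih (by simpa using hL k 0)
        linarith
    simp only [integral_zero_measure]
    linarith
  · obtain ⟨μ, hμ⟩ := exists_probabilityMeasure_moments ((L 1)⁻¹ • L)
      (fun k j => mul_nonneg (inv_nonneg.2 h0.le) (hL k j)) (by simp [h0.ne'])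
    refine ⟨ENNReal.ofReal (L 1) • (μ : Measure unitInterval), Measure.smul_finite _ ENNReal.ofReal_ne_top,
      fun k => ?_⟩
    rw [integral_smul_measure, hμ, ENNReal.toReal_ofReal h0.le]
    simp [h0.ne']

/-- Uniqueness in the Hausdorff moment problem. -/
lemma measure_eq_of_moments_eq (μ ν : Measure unitInterval) [IsFiniteMeasure μ] [IsFiniteMeasure ν]
    (h : ∀ k : ℕ, ∫ x : unitInterval, (x : ℝ) ^ k ∂μ = ∫ x : unitInterval, (x : ℝ) ^ k ∂ν) :
    μ = ν := by
  have hInt : ∀ (ρ : Measure unitInterval) [IsFiniteMeasure ρ] (g : C(unitInterval, ℝ)),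
      Integrable g ρ :=
    fun ρ _ g => (BoundedContinuousFunction.mkOfCompact g).integrable ρ
  have hcont : ∀ (ρ : Measure unitInterval) [IsFiniteMeasure ρ],
      Continuous fun g : C(unitInterval, ℝ) => ∫ x, g x ∂ρ := by
    intro ρ _
    have := (ContinuousMap.toLp (E := ℝ) 1 ρ ℝ).continuous
    have h2 := continuous_integral.comp this
    convert h2 using 2 with g
    exact integral_congr_ae (ContinuousMap.coeFn_toLp ρ g).symm
  have hpoly : ∀ p : ℝ[X],
      ∫ x : unitInterval, p.eval (x : ℝ) ∂μ = ∫ x : unitInterval, p.eval (x : ℝ) ∂ν := by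
    intro p
    simp only [Polynomial.eval_eq_sum_range]
    rw [integral_finsetSum, integral_finsetSum]
    · simp only [integral_const_mul, h]
    · exact fun i _ => hInt ν ⟨fun x : unitInterval => p.coeff i * (x : ℝ) ^ i, by fun_prop⟩
    · exact fun i _ => hInt μ ⟨fun x : unitInterval => p.coeff i * (x : ℝ) ^ i, by fun_prop⟩
  have hall : ∀ g : C(unitInterval, ℝ), ∫ x, g x ∂μ = ∫ x, g x ∂ν := by
    intro g
    have hg : g ∈ (polynomialFunctions unitInterval).topologicalClosure := by
      rw [polynomialFunctions_closure_eq_top']; trivial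
    have hcl : IsClosed {g : C(unitInterval, ℝ) | ∫ x, g x ∂μ = ∫ x, g x ∂ν} :=
      isClosed_eq (hcont μ) (hcont ν)
    refine hcl.closure_subset_iff.2 ?_ hg
    rintro _ ⟨p, -, rfl⟩
    simpa using hpoly p
  exact ext_of_forall_integral_eq_of_IsFiniteMeasure fun g => hall g.toContinuousMap

/-- `φ (‖x - y‖ ^ 2)` is a positive definite kernel on `ℝ ^ d` for every `d`. -/
def IsRadialPD (φ : ℝ → ℝ) : Prop :=
  ∀ (d n : ℕ) (y : Fin n → EuclideanSpace ℝ (Fin d)) (c : Fin n → ℝ),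
    0 ≤ ∑ k, ∑ l, c k * c l * φ (‖y k - y l‖ ^ 2)

/-- Adjoining the coordinate `b` to a point of `ℝ ^ d`. -/
def euclideanCons {d : ℕ} (b : ℝ) (y : EuclideanSpace ℝ (Fin d)) :
    EuclideanSpace ℝ (Fin (d + 1)) :=
  WithLp.toLp 2 (Fin.cons b y)

lemma norm_sq_euclideanCons_sub {d : ℕ} (a b : ℝ) (y z : EuclideanSpace ℝ (Fin d)) :
    ‖euclideanCons a y - euclideanCons b z‖ ^ 2 = ‖y - z‖ ^ 2 + (a - b) ^ 2 := by
  simp [EuclideanSpace.norm_sq_eq, Fin.sum_univ_succ, euclideanCons, add_comm]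

/-- Doubling a configuration of points in an orthogonal direction, with opposite weights. -/
lemma sum_doubled_configuration (F : ℝ → ℝ) {a : ℝ} (ha : 0 ≤ a) {d n : ℕ}
    (y : Fin n → EuclideanSpace ℝ (Fin d)) (c : Fin n → ℝ) :
    let y' : Fin (n + n) → EuclideanSpace ℝ (Fin (d + 1)) :=
      Fin.append (fun i => euclideanCons 0 (y i)) (fun i => euclideanCons (√a) (y i))
    let c' : Fin (n + n) → ℝ := Fin.append c (fun i => -c i)
    ∑ k, ∑ l, c' k * c' l * F (‖y' k - y' l‖ ^ 2)
      = 2 * ∑ k, ∑ l, c k * c l * (F (‖y k - y l‖ ^ 2) - F (‖y k - y l‖ ^ 2 + a)) := by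
  intro y' c'
  simp only [Fin.sum_univ_add, y', c', Fin.append_left, Fin.append_right,
    norm_sq_euclideanCons_sub, sub_self, zero_sub, sub_zero, neg_sq, Real.sq_sqrt ha]
  rw [Finset.mul_sum, ← Finset.sum_add_distrib]
  refine Finset.sum_congr rfl fun k _ => ?_
  rw [Finset.mul_sum, ← Finset.sum_add_distrib, ← Finset.sum_add_distrib,
    ← Finset.sum_add_distrib]
  refine Finset.sum_congr rfl fun l _ => ?_
  norm_num
  ring

lemma IsRadialPD.sub_shift {φ : ℝ → ℝ} (hφ : IsRadialPD φ) {a : ℝ} (ha : 0 ≤ a) :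
    IsRadialPD fun s => φ s - φ (s + a) := by
  intro d n y c
  have := hφ _ _ (Fin.append (fun i => euclideanCons 0 (y i)) (fun i => euclideanCons (√a) (y i)))
    (Fin.append c (fun i => -c i))
  rw [sum_doubled_configuration φ ha y c] at this
  linarith

lemma isRadialPD_shift_sub {h : ℝ → ℝ}
    (hh : ∀ d : ℕ, IsCND fun x y : EuclideanSpace ℝ (Fin d) => h (‖x - y‖ ^ 2))
    {a : ℝ} (ha : 0 ≤ a) : IsRadialPD fun s => h (s + a) - h s := by
  intro d n y c
  have := hh _ _ (Fin.append (fun i => euclideanCons 0 (y i)) (fun i => euclideanCons (√a) (y i)))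
    (Fin.append c (fun i => -c i)) (by
      simp only [Fin.sum_univ_add, Fin.append_left, Fin.append_right]
      simp)
  rw [sum_doubled_configuration h ha y c] at this
  have e : ∑ k, ∑ l, c k * c l * (h (‖y k - y l‖ ^ 2 + a) - h (‖y k - y l‖ ^ 2))
      = - ∑ k, ∑ l, c k * c l * (h (‖y k - y l‖ ^ 2) - h (‖y k - y l‖ ^ 2 + a)) := by
    simp only [← Finset.sum_neg_distrib]
    exact Finset.sum_congr rfl fun k _ => Finset.sum_congr rfl fun l _ => by ring
  rw [e]
  linarith

/-- A function that is radially positive definite in all dimensions is nonnegative: test it on the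
vertices of large regular simplices. -/
lemma IsRadialPD.nonneg {φ : ℝ → ℝ} (hφ : IsRadialPD φ) {t : ℝ} (ht : 0 ≤ t) : 0 ≤ φ t := by
  have key : ∀ N : ℕ, 0 ≤ φ 0 / (N + 1 : ℝ) + (1 - 1 / (N + 1 : ℝ)) * φ t := by
    intro N
    let y : Fin (N + 1) → EuclideanSpace ℝ (Fin (N + 1)) := fun i =>
      EuclideanSpace.single i (√(t / 2))
    have hy : ∀ k l, φ (‖y k - y l‖ ^ 2) = φ t + if k = l then φ 0 - φ t else 0 := by
      intro k l
      split_ifs with hkl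
      · simp [hkl]
      · have : ‖y k - y l‖ ^ 2 = t := by
          rw [@norm_sub_sq ℝ]
          simp [y, EuclideanSpace.inner_single_left, hkl]
          rw [div_pow, sq_abs, sq_abs, Real.sq_sqrt ht, Real.sq_sqrt zero_le_two]
          ring
        rw [this, add_zero]
    have h := hφ _ _ y (fun _ => 1 / (N + 1 : ℝ))
    simp only [hy, ← Finset.mul_sum, Finset.sum_add_distrib, Finset.sum_ite_eq,
      Finset.mem_univ, if_true, Finset.sum_const, Finset.card_univ, Fintype.card_fin,
      nsmul_eq_mul] at h
    refine h.trans_eq ?_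
    push_cast
    field_simp
    ring
  have hlim : Tendsto (fun N : ℕ => φ 0 / (N + 1 : ℝ) + (1 - 1 / (N + 1 : ℝ)) * φ t) atTop
      (𝓝 (0 + (1 - 0) * φ t)) := by
    have h1 := tendsto_one_div_add_atTop_nhds_zero_nat (𝕜 := ℝ)
    refine Tendsto.add ?_ ((h1.const_sub 1).mul_const _)
    simpa [div_eq_mul_inv] using h1.const_mul (φ 0)
  simpa using ge_of_tendsto' hlim key

/-- The linear functional on polynomials with `X ^ k ↦ φ (k * δ)`. -/
def gridFunctional (φ : ℝ → ℝ) (δ : ℝ) : ℝ[X] →ₗ[ℝ] ℝ :=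
  Polynomial.lsum fun k => φ (k * δ) • LinearMap.id

lemma gridFunctional_monomial (φ : ℝ → ℝ) (δ : ℝ) (k : ℕ) (a : ℝ) :
    gridFunctional φ δ (monomial k a) = φ (k * δ) * a := by
  simp [gridFunctional, Polynomial.lsum_apply, Polynomial.sum_monomial_index]

lemma gridFunctional_X_pow (φ : ℝ → ℝ) (δ : ℝ) (k : ℕ) :
    gridFunctional φ δ (X ^ k) = φ (k * δ) := by
  rw [X_pow_eq_monomial, gridFunctional_monomial, mul_one]

lemma gridFunctional_mul_one_sub_X (φ : ℝ → ℝ) (δ : ℝ) (q : ℝ[X]) :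
    gridFunctional φ δ (q * (1 - X)) = gridFunctional (fun s => φ s - φ (s + δ)) δ q := by
  induction q using Polynomial.induction_on' with
  | add p q hp hq => rw [add_mul, map_add, map_add, hp, hq]
  | monomial k a =>
    rw [mul_sub, mul_one, monomial_mul_X, map_sub, gridFunctional_monomial,
      gridFunctional_monomial, gridFunctional_monomial]
    push_cast
    ring_nf

lemma IsRadialPD.gridFunctional_nonneg {φ : ℝ → ℝ} (hφ : IsRadialPD φ) {δ : ℝ} (hδ : 0 ≤ δ)
    (k j : ℕ) : 0 ≤ gridFunctional φ δ (X ^ k * (1 - X) ^ j) := by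
  induction j generalizing φ with
  | zero =>
    rw [pow_zero, mul_one, gridFunctional_X_pow]
    exact hφ.nonneg (by positivity)
  | succ j ih =>
    rw [pow_succ, ← mul_assoc, gridFunctional_mul_one_sub_X]
    exact ih (hφ.sub_shift hδ)

/-- The kernel `(1 - x ^ s) / (1 - x)`, whose value at `x = 1` is its limit `s`. -/
def powQuotient (x s : ℝ) : ℝ := if x = 1 then s else (1 - x ^ s) / (1 - x)

lemma powQuotient_natCast (x : ℝ) (k : ℕ) : powQuotient x k = ∑ i ∈ range k, x ^ i := by
  unfold powQuotient
  split_ifs with h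
  · simp [h]
  · rw [geom_sum_eq h, Real.rpow_natCast, ← neg_div_neg_eq, neg_sub, neg_sub]

lemma powQuotient_pow_mul {x : ℝ} (hx0 : 0 ≤ x) {M : ℕ} (hM : M ≠ 0) (k : ℕ) :
    powQuotient (x ^ M) (k / M) * ∑ i ∈ range M, x ^ i = ∑ i ∈ range k, x ^ i := by
  have hM' : (M : ℝ) ≠ 0 := Nat.cast_ne_zero.2 hM
  unfold powQuotient
  simp only [pow_eq_one_iff_of_nonneg hx0 hM]
  split_ifs with h
  · simp [h, hM']
  · have h1 : x ^ M - 1 ≠ 0 := by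
      rwa [sub_ne_zero, ne_eq, pow_eq_one_iff_of_nonneg hx0 hM]
    have h2 : (x ^ M) ^ ((k : ℝ) / M) = x ^ k := by
      rw [← Real.rpow_natCast, ← Real.rpow_mul hx0, mul_div_cancel₀ _ hM', Real.rpow_natCast]
    rw [geom_sum_eq h, geom_sum_eq h, h2, ← neg_div_neg_eq, neg_sub, neg_sub]
    field_simp

lemma powQuotient_nonneg {x s : ℝ} (hx0 : 0 ≤ x) (hx1 : x ≤ 1) (hs : 0 ≤ s) :
    0 ≤ powQuotient x s := by
  unfold powQuotient
  split_ifs with h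
  · exact hs
  · exact div_nonneg (sub_nonneg.2 (Real.rpow_le_one hx0 hx1 hs)) (sub_nonneg.2 hx1)

lemma powQuotient_le {x s : ℝ} (hx0 : 0 ≤ x) (hx1 : x ≤ 1) (hs : 0 ≤ s) {n : ℕ} (hn : s ≤ n) :
    powQuotient x s ≤ n := by
  by_cases h : x = 1
  · simpa [powQuotient, h] using hn
  calc powQuotient x s ≤ powQuotient x n := by
        simp only [powQuotient, h, if_false]
        exact div_le_div_of_nonneg_right
          (sub_le_sub_left (Real.rpow_le_rpow_of_exponent_ge' hx0 hx1 hs hn) 1)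
          (sub_nonneg.2 hx1)
    _ = ∑ i ∈ range n, x ^ i := powQuotient_natCast x n
    _ ≤ ∑ i ∈ range n, (1 : ℝ) := Finset.sum_le_sum fun i _ => pow_le_one₀ hx0 hx1
    _ = n := by simp

lemma continuousAt_powQuotient {x s : ℝ} (hs : 0 < s) : ContinuousAt (powQuotient x) s := by
  unfold powQuotient
  split_ifs with h
  · exact continuousAt_id
  · refine ContinuousAt.div_const (continuousAt_const.sub ?_) _
    exact Real.continuousAt_const_rpow' hs.ne'

lemma measurable_powQuotient (s : ℝ) : Measurable fun x => powQuotient x s := by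
  unfold powQuotient
  refine Measurable.ite (measurableSet_eq) measurable_const ?_
  fun_prop

lemma aestronglyMeasurable_powQuotient (μ : Measure unitInterval) (s : ℝ) :
    AEStronglyMeasurable (fun x : unitInterval => powQuotient x s) μ :=
  ((measurable_powQuotient s).comp measurable_subtype_coe).aestronglyMeasurable

lemma integrable_powQuotient (μ : Measure unitInterval) [IsFiniteMeasure μ] {s : ℝ} (hs : 0 ≤ s) :
    Integrable (fun x : unitInterval => powQuotient x s) μ := by
  obtain ⟨n, hn⟩ := exists_nat_ge s
  refine Integrable.of_bound (aestronglyMeasurable_powQuotient μ s) n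
    (Eventually.of_forall fun x => ?_)
  rw [Real.norm_of_nonneg (powQuotient_nonneg x.2.1 x.2.2 hs)]
  exact powQuotient_le x.2.1 x.2.2 hs hn

lemma measure_eq_of_integral_powQuotient_eq (μ ν : Measure unitInterval) [IsFiniteMeasure μ]
    [IsFiniteMeasure ν]
    (h : ∀ k : ℕ, ∫ x : unitInterval, powQuotient x k ∂μ = ∫ x : unitInterval, powQuotient x k ∂ν) :
    μ = ν := by
  refine measure_eq_of_moments_eq μ ν fun k => ?_
  have e : ∀ ρ : Measure unitInterval, IsFiniteMeasure ρ → ∫ x : unitInterval, (x : ℝ) ^ k ∂ρ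
      = ∫ x : unitInterval, powQuotient x (k + 1 : ℕ) ∂ρ - ∫ x : unitInterval, powQuotient x k ∂ρ := by
    intro ρ _
    rw [← integral_sub (integrable_powQuotient ρ (Nat.cast_nonneg _))
      (integrable_powQuotient ρ (Nat.cast_nonneg _))]
    simp only [powQuotient_natCast, Finset.sum_range_succ, add_sub_cancel_left]
  rw [e μ inferInstance, e ν inferInstance, h, h]

lemma exists_measure_powQuotient_grid {h : ℝ → ℝ} (h0 : h 0 = 0)
    (hh : ∀ d : ℕ, IsCND fun x y : EuclideanSpace ℝ (Fin d) => h (‖x - y‖ ^ 2))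
    {M : ℕ} (hM : M ≠ 0) :
    ∃ μ : Measure unitInterval, IsFiniteMeasure μ ∧
      ∀ k : ℕ, h (k / M) = ∫ x : unitInterval, powQuotient x (k / M) ∂μ := by
  have hM' : (M : ℝ) ≠ 0 := Nat.cast_ne_zero.2 hM
  have hδ : (0 : ℝ) ≤ 1 / M := by positivity
  obtain ⟨ν, hν, hmom⟩ := exists_measure_moments _
    ((isRadialPD_shift_sub hh hδ).gridFunctional_nonneg hδ)
  simp only [gridFunctional_X_pow] at hmom
  have hInt : ∀ i : ℕ, Integrable (fun x : unitInterval => (x : ℝ) ^ i) ν := fun i =>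
    (BoundedContinuousFunction.mkOfCompact
      (⟨fun x : unitInterval => (x : ℝ) ^ i, by fun_prop⟩ : C(unitInterval, ℝ))).integrable ν
  have hsum : ∀ k : ℕ, ∫ x : unitInterval, ∑ i ∈ range k, (x : ℝ) ^ i ∂ν = h (k / M) := by
    intro k
    rw [integral_finsetSum _ fun i _ => hInt i]
    have e : ∀ i : ℕ, ∫ x : unitInterval, (x : ℝ) ^ i ∂ν = h ((i + 1 : ℕ) / M) - h ((i : ℕ) / M) := by
      intro i
      rw [hmom]
      push_cast
      ring_nf
    simp only [e]
    rw [Finset.sum_range_sub (fun i : ℕ => h (i / M))]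
    simp [h0]
  let w : unitInterval → NNReal := fun x => (∑ i ∈ range M, (x : ℝ) ^ i).toNNReal
  have hw : Measurable w := by
    apply Measurable.real_toNNReal
    fun_prop
  have hw' : ∀ x : unitInterval, (w x : ℝ) = ∑ i ∈ range M, (x : ℝ) ^ i := fun x =>
    Real.coe_toNNReal _ (Finset.sum_nonneg fun i _ => pow_nonneg x.2.1 i)
  have hfin : IsFiniteMeasure (ν.withDensity fun x => (w x : ENNReal)) := by
    refine isFiniteMeasure_withDensity_ofReal (f := fun x : unitInterval => ∑ i ∈ range M, (x : ℝ) ^ i) ?_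
    exact (integrable_finsetSum _ fun i _ => hInt i).2
  have hpow : Measurable fun x : unitInterval => x ^ M := (by fun_prop : Continuous _).measurable
  refine ⟨(ν.withDensity fun x => (w x : ENNReal)).map fun x => x ^ M, inferInstance, fun k => ?_⟩
  rw [integral_map hpow.aemeasurable (aestronglyMeasurable_powQuotient _ _),
    integral_withDensity_eq_integral_smul hw, ← hsum]
  refine integral_congr_ae (Eventually.of_forall fun x => ?_)
  simp only [NNReal.smul_def, hw', smul_eq_mul]
  rw [mul_comm, ← powQuotient_pow_mul x.2.1 hM k]
  simp

/-- The representation of a continuous function which is radially conditionally negative definite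
in all dimensions, over the unit interval. -/
lemma exists_measure_powQuotient {h : ℝ → ℝ} (hc : ContinuousOn h (Set.Ici 0)) (h0 : h 0 = 0)
    (hh : ∀ d : ℕ, IsCND fun x y : EuclideanSpace ℝ (Fin d) => h (‖x - y‖ ^ 2)) :
    ∃ μ : Measure unitInterval, IsFiniteMeasure μ ∧ μ {0} = 0 ∧
      ∀ s : ℝ, 0 ≤ s → h s = ∫ x : unitInterval, powQuotient x s ∂μ := by
  obtain ⟨μ, hμ, hμ1⟩ := exists_measure_powQuotient_grid h0 hh one_ne_zero
  simp only [Nat.cast_one, div_one] at hμ1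
  have hrat : ∀ (k M : ℕ), M ≠ 0 → h (k / M) = ∫ x : unitInterval, powQuotient x (k / M) ∂μ := by
    intro k M hM
    obtain ⟨ν, hν, hν1⟩ := exists_measure_powQuotient_grid h0 hh hM
    have : ν = μ := by
      refine measure_eq_of_integral_powQuotient_eq ν μ fun j => ?_
      have := hν1 (j * M)
      rw [Nat.cast_mul, mul_div_cancel_right₀ _ (Nat.cast_ne_zero.2 hM)] at this
      rw [← this, hμ1]
    rw [← this]
    exact hν1 k
  have hcont : ContinuousOn (fun s => ∫ x : unitInterval, powQuotient x s ∂μ) (Set.Ioi 0) := by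
    intro s hs
    apply ContinuousAt.continuousWithinAt
    obtain ⟨n, hn⟩ := exists_nat_gt s
    refine continuousAt_of_dominated (bound := fun _ => (n : ℝ)) ?_ ?_ (integrable_const _) ?_
    · exact Eventually.of_forall (aestronglyMeasurable_powQuotient μ)
    · filter_upwards [Ioo_mem_nhds hs hn] with s' hs'
      refine Eventually.of_forall fun x => ?_
      rw [Real.norm_of_nonneg (powQuotient_nonneg x.2.1 x.2.2 hs'.1.le)]
      exact powQuotient_le x.2.1 x.2.2 hs'.1.le hs'.2.le
    · exact Eventually.of_forall fun x => continuousAt_powQuotient hs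
  have hpos : Set.EqOn h (fun s => ∫ x : unitInterval, powQuotient x s ∂μ) (Set.Ioi 0) := by
    refine Set.EqOn.of_subset_closure (s := Set.Ioi 0 ∩ Set.range ((↑) : ℚ → ℝ)) ?_
      (hc.mono Set.Ioi_subset_Ici_self) hcont Set.inter_subset_left ?_
    · rintro _ ⟨hq, q, rfl⟩
      have hq' : (0 : ℚ) ≤ q := by exact_mod_cast (le_of_lt (Set.mem_Ioi.1 hq))
      have e : (q : ℝ) = (q.num.toNat : ℕ) / (q.den : ℕ) := by
        have h1 : ((q.num.toNat : ℕ) : ℤ) = q.num := Int.toNat_of_nonneg (Rat.num_nonneg.2 hq')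
        have h2 : ((q.num.toNat : ℕ) : ℝ) = (q.num : ℝ) := by exact_mod_cast h1
        rw [h2]
        exact Rat.cast_def q
      simp only [e]
      exact hrat _ _ q.den_nz
    · exact Rat.denseRange_cast.open_subset_closure_inter isOpen_Ioi
  have hzero : μ {0} = 0 := by
    have hle : ∀ s : ℝ, 0 < s → μ.real {0} ≤ h s := by
      intro s hs
      rw [hpos hs, ← integral_indicator_one (measurableSet_singleton _)]
      refine integral_mono ?_ (integrable_powQuotient μ hs.le) fun x => ?_
      · exact (integrable_const (1 : ℝ)).indicator (measurableSet_singleton _)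
      · by_cases hx : x = 0
        · simp [hx, powQuotient, Real.zero_rpow hs.ne']
        · simpa [hx] using powQuotient_nonneg x.2.1 x.2.2 hs.le
    have hlim : Tendsto h (𝓝[>] 0) (𝓝 0) := by
      have := (hc 0 Set.self_mem_Ici).tendsto
      rw [h0] at this
      exact this.mono_left (nhdsWithin_mono _ Set.Ioi_subset_Ici_self)
    have : μ.real {0} ≤ 0 := by
      refine ge_of_tendsto hlim ?_
      filter_upwards [self_mem_nhdsWithin] with s hs using hle s hs
    exact (measureReal_eq_zero_iff).1 (le_antisymm this measureReal_nonneg)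
  refine ⟨μ, hμ, hzero, fun s hs => ?_⟩
  rcases hs.eq_or_lt with rfl | hs
  · simpa using hrat 0 1 one_ne_zero
  · exact hpos hs

lemma G8_eq_dslope (r : NNReal) (t : ℝ) :
    G8 r t = (1 + (r : ℝ)) * dslope (fun x : ℝ => 1 - Real.exp (-x * t ^ 2)) 0 r := by
  unfold G8
  split_ifs with h
  · simp [h]
  · have h' : (r : ℝ) ≠ 0 := by exact_mod_cast h
    rw [dslope_of_ne _ h', slope_def_field]
    simp only [neg_zero, zero_mul, Real.exp_zero, sub_self, sub_zero]
    ring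

lemma continuous_G8 (t : ℝ) : Continuous fun r : NNReal => G8 r t := by
  simp only [G8_eq_dslope]
  have hd : Differentiable ℝ fun x : ℝ => 1 - Real.exp (-x * t ^ 2) := by fun_prop
  have : Continuous (dslope (fun x : ℝ => 1 - Real.exp (-x * t ^ 2)) 0) := by
    rw [continuous_iff_continuousAt]
    intro x
    rcases eq_or_ne x 0 with rfl | hx
    · exact continuousAt_dslope_same.2 (hd 0)
    · exact (continuousAt_dslope_of_ne hx).2 (hd x).continuousAt
  fun_prop

lemma measurable_G8 (t : ℝ) : Measurable fun r : NNReal => G8 r t := (continuous_G8 t).measurable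

lemma G8_nonneg (r : NNReal) (t : ℝ) : 0 ≤ G8 r t := by
  unfold G8
  split_ifs with h
  · positivity
  · have : Real.exp (-(r : ℝ) * t ^ 2) ≤ 1 := by
      rw [Real.exp_le_one_iff]
      have : 0 ≤ (r : ℝ) * t ^ 2 := by positivity
      linarith
    have := sub_nonneg.2 this
    positivity

lemma G8_le (r : NNReal) (t : ℝ) : G8 r t ≤ t ^ 2 + 1 := by
  unfold G8
  split_ifs with h
  · linarith
  · have hr : 0 < (r : ℝ) := by exact_mod_cast pos_iff_ne_zero.2 h
    rw [div_le_iff₀ hr]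
    have h1 := Real.add_one_le_exp (-(r : ℝ) * t ^ 2)
    have h2 := Real.exp_pos (-(r : ℝ) * t ^ 2)
    nlinarith

lemma norm_G8_le (r : NNReal) (t : ℝ) : ‖G8 r t‖ ≤ t ^ 2 + 1 := by
  rw [Real.norm_of_nonneg (G8_nonneg r t)]
  exact G8_le r t

lemma integrable_G8 (σ : Measure NNReal) [IsFiniteMeasure σ] (t : ℝ) :
    Integrable (fun r => G8 r t) σ :=
  Integrable.of_bound (measurable_G8 t).aestronglyMeasurable (t ^ 2 + 1)
    (Eventually.of_forall fun r => norm_G8_le r t)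

lemma one_le_G8_one (r : NNReal) : 1 ≤ G8 r 1 := by
  unfold G8
  split_ifs with h
  · simp
  · have hr : 0 < (r : ℝ) := by exact_mod_cast pos_iff_ne_zero.2 h
    rw [le_div_iff₀ hr]
    have h1 : Real.exp (-(r : ℝ)) * (r + 1) ≤ Real.exp (-(r : ℝ)) * Real.exp r :=
      mul_le_mul_of_nonneg_left (Real.add_one_le_exp _) (Real.exp_pos _).le
    rw [← Real.exp_add, neg_add_cancel, Real.exp_zero] at h1
    simp only [one_pow, mul_one]
    linarith

lemma G8_eq_mul_powQuotient (r : NNReal) (t : ℝ) :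
    G8 r t = G8 r 1 * powQuotient (Real.exp (-r)) (t ^ 2) := by
  unfold G8 powQuotient
  split_ifs with h h' h'
  · simp
  · simp [h] at h'
  · simp [h] at h'
  · have h1 : (1 : ℝ) - Real.exp (-r) ≠ 0 := sub_ne_zero.2 (Ne.symm h')
    have h2 : (r : ℝ) ≠ 0 := by exact_mod_cast h
    rw [← Real.exp_mul]
    simp only [one_pow, mul_one]
    field_simp

/-- The map `r ↦ exp (-r)` from `[0, ∞)` to the unit interval. -/
def expNeg (r : NNReal) : unitInterval := ⟨Real.exp (-r), (Real.exp_pos _).le, by simp⟩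

/-- The map `x ↦ -log x` from the unit interval to `[0, ∞)`. -/
def negLog (x : unitInterval) : NNReal := (-Real.log x).toNNReal

lemma measurable_expNeg : Measurable expNeg := by
  unfold expNeg
  exact Measurable.subtype_mk (by fun_prop)

lemma measurable_negLog : Measurable negLog := by
  unfold negLog
  fun_prop

lemma negLog_expNeg (r : NNReal) : negLog (expNeg r) = r := by
  simp [negLog, expNeg]

lemma expNeg_negLog {x : unitInterval} (hx : x ≠ 0) : expNeg (negLog x) = x := by
  have h0 : 0 < (x : ℝ) := lt_of_le_of_ne x.2.1 fun h => hx (Subtype.ext h.symm)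
  apply Subtype.ext
  simp only [expNeg, negLog]
  rw [Real.coe_toNNReal _ (neg_nonneg.2 (Real.log_nonpos x.2.1 x.2.2)), neg_neg, Real.exp_log h0]

/-- The weight `G8 r 1`, as a nonnegative number. -/
def weightG8 (r : NNReal) : NNReal := (G8 r 1).toNNReal

lemma coe_weightG8 (r : NNReal) : (weightG8 r : ℝ) = G8 r 1 :=
  Real.coe_toNNReal _ (G8_nonneg r 1)

lemma weightG8_ne_zero (r : NNReal) : weightG8 r ≠ 0 := by
  have : (weightG8 r : ℝ) ≠ 0 := by
    rw [coe_weightG8]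
    linarith [one_le_G8_one r]
  exact_mod_cast this

lemma measurable_weightG8 : Measurable weightG8 := (measurable_G8 1).real_toNNReal

lemma isFiniteMeasure_withDensity_weightG8 (σ : Measure NNReal) [IsFiniteMeasure σ] :
    IsFiniteMeasure (σ.withDensity fun r => (weightG8 r : ENNReal)) :=
  isFiniteMeasure_withDensity_ofReal (integrable_G8 σ 1).2

lemma integral_G8_eq_integral_powQuotient (σ : Measure NNReal) (t : ℝ) :
    ∫ r, G8 r t ∂σ = ∫ x : unitInterval, powQuotient x (t ^ 2)
      ∂((σ.withDensity fun r => (weightG8 r : ENNReal)).map expNeg) := by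
  rw [integral_map measurable_expNeg.aemeasurable (aestronglyMeasurable_powQuotient _ _),
    integral_withDensity_eq_integral_smul measurable_weightG8]
  refine integral_congr_ae (Eventually.of_forall fun r => ?_)
  simp only [NNReal.smul_def, coe_weightG8, smul_eq_mul]
  exact G8_eq_mul_powQuotient r t

/-- A finite measure on `[0, ∞)` is determined by its integrals against `G8`. -/
lemma measure_eq_of_integral_G8_eq (σ σ' : Measure NNReal) [IsFiniteMeasure σ] [IsFiniteMeasure σ']
    (h : ∀ t : ℝ, 0 ≤ t → ∫ r, G8 r t ∂σ = ∫ r, G8 r t ∂σ') : σ = σ' := by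
  have := isFiniteMeasure_withDensity_weightG8 σ
  have := isFiniteMeasure_withDensity_weightG8 σ'
  have h1 := measure_eq_of_integral_powQuotient_eq
    ((σ.withDensity fun r => (weightG8 r : ENNReal)).map expNeg)
    ((σ'.withDensity fun r => (weightG8 r : ENNReal)).map expNeg) fun k => by
      have := h (√k) (Real.sqrt_nonneg _)
      rwa [integral_G8_eq_integral_powQuotient, integral_G8_eq_integral_powQuotient,
        Real.sq_sqrt (Nat.cast_nonneg _)] at this
  have h2 : (σ.withDensity fun r => (weightG8 r : ENNReal))
      = σ'.withDensity fun r => (weightG8 r : ENNReal) := by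
    have h3 := congrArg (Measure.map negLog) h1
    rw [Measure.map_map measurable_negLog measurable_expNeg,
      Measure.map_map measurable_negLog measurable_expNeg] at h3
    have h4 : negLog ∘ expNeg = id := funext negLog_expNeg
    rwa [h4, Measure.map_id, Measure.map_id] at h3
  have h5 : ∀ τ : Measure NNReal, (τ.withDensity fun r => (weightG8 r : ENNReal)).withDensity
      (fun r => (weightG8 r : ENNReal))⁻¹ = τ := fun τ =>
    withDensity_inv_same (measurable_coe_nnreal_ennreal.comp measurable_weightG8)
      (Eventually.of_forall fun r => by simpa using weightG8_ne_zero r)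
      (Eventually.of_forall fun r => ENNReal.coe_ne_top)
  rw [← h5 σ, h2, h5 σ']

/-- **Schoenberg's theorem**: the representation of continuous functions that are radially
conditionally negative definite in all dimensions. -/
lemma exists_measure_G8 {g : ℝ → ℝ} (hc : ContinuousOn g (Set.Ici 0)) (h0 : g 0 = 0)
    (hg : ∀ d : ℕ, IsCND fun x y : EuclideanSpace ℝ (Fin d) => g ‖x - y‖) :
    ∃ σ : Measure NNReal, IsFiniteMeasure σ ∧ ∀ t : ℝ, 0 ≤ t → g t = ∫ r, G8 r t ∂σ := by
  have hc' : ContinuousOn (fun s => g (√s)) (Set.Ici 0) :=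
    hc.comp Real.continuous_sqrt.continuousOn fun s _ => Real.sqrt_nonneg s
  obtain ⟨μ, hμ, hμ0, hrep⟩ := exists_measure_powQuotient hc' (by simpa using h0)
    (fun d => by simpa only [Real.sqrt_sq (norm_nonneg _)] using hg d)
  have hw : Measurable fun r => (weightG8 r)⁻¹ := measurable_weightG8.inv
  refine ⟨(μ.map negLog).withDensity fun r => (((weightG8 r)⁻¹ : NNReal) : ENNReal), ?_,
    fun t ht => ?_⟩
  · refine isFiniteMeasure_withDensity (ne_of_lt ?_)
    calc ∫⁻ r, (((weightG8 r)⁻¹ : NNReal) : ENNReal) ∂(μ.map negLog)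
        ≤ ∫⁻ r, 1 ∂(μ.map negLog) := by
          refine lintegral_mono fun r => ?_
          have : 1 ≤ weightG8 r := by
            rw [← NNReal.coe_le_coe, coe_weightG8]
            exact one_le_G8_one r
          exact ENNReal.coe_le_one_iff.2 (inv_le_one_of_one_le₀ this)
      _ < ⊤ := by simp
  · rw [integral_withDensity_eq_integral_smul hw, integral_map measurable_negLog.aemeasurable]
    · have := hrep (t ^ 2) (sq_nonneg t)
      simp only [Real.sqrt_sq ht] at this
      rw [this]
      have hne : ∀ᵐ x ∂μ, x ≠ 0 := by
        rw [ae_iff]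
        simpa using hμ0
      refine integral_congr_ae ?_
      filter_upwards [hne] with x hx
      have e : Real.exp (-(negLog x : ℝ)) = x := congrArg Subtype.val (expNeg_negLog hx)
      rw [G8_eq_mul_powQuotient, e, NNReal.smul_def, NNReal.coe_inv, coe_weightG8, smul_eq_mul,
        inv_mul_cancel_left₀ (by linarith [one_le_G8_one (negLog x)])]
    · exact (Measurable.smul hw (measurable_G8 t)).aestronglyMeasurable

lemma exp_neg_mul_norm_sq_eq_integral {d : ℕ} {r : ℝ} (hr : 0 ≤ r)
    (y z : EuclideanSpace ℝ (Fin d)) :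
    Real.exp (-r * ‖y - z‖ ^ 2) =
      ∫ ξ, Real.cos (inner ℝ ξ (√(2 * r) • y) - inner ℝ ξ (√(2 * r) • z)) ∂(ProbabilityTheory.stdGaussian (EuclideanSpace ℝ (Fin d))) := by
  have h := ProbabilityTheory.charFun_stdGaussian (E := EuclideanSpace ℝ (Fin d))
    (√(2 * r) • (y - z))
  have h' := congrArg Complex.re h
  rw [charFun_apply, ← RCLike.re_eq_complex_re, ← integral_re] at h'
  · have e : -r * ‖y - z‖ ^ 2 = -‖√(2 * r) • (y - z)‖ ^ 2 / 2 := by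
      rw [norm_smul, mul_pow, Real.norm_of_nonneg (Real.sqrt_nonneg _),
        Real.sq_sqrt (by positivity)]
      ring
    rw [e]
    convert! h'.symm using 1
    · rw [RCLike.re_eq_complex_re, ← Complex.ofReal_pow, ← Complex.ofReal_neg,
        ← Complex.ofReal_ofNat, ← Complex.ofReal_div, ← Complex.ofReal_exp, Complex.ofReal_re]
    · refine integral_congr_ae (Eventually.of_forall fun ξ => ?_)
      simp only [RCLike.re_eq_complex_re, Complex.exp_ofReal_mul_I_re]
      rw [smul_sub, inner_sub_right]
  · refine Integrable.of_bound (C := 1) (by fun_prop) (Eventually.of_forall fun ξ => ?_)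
    rw [Complex.norm_exp_ofReal_mul_I]

/-- The tensor product of a conditionally negative definite matrix and a Gaussian kernel. -/
lemma sum_cnd_mul_gaussian_nonpos {n m d : ℕ} (γ : Fin n → Fin n → ℝ)
    (hγ : ∀ a : Fin n → ℝ, ∑ i, a i = 0 → ∑ i, ∑ j, a i * a j * γ i j ≤ 0)
    (c : Fin n → Fin m → ℝ) (hc : ∀ k, ∑ i, c i k = 0)
    (y : Fin m → EuclideanSpace ℝ (Fin d)) {r : ℝ} (hr : 0 ≤ r) :
    ∑ i, ∑ j, ∑ k, ∑ l, c i k * c j l * (γ i j * Real.exp (-r * ‖y k - y l‖ ^ 2)) ≤ 0 := by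
  simp only [exp_neg_mul_norm_sq_eq_integral hr, ← integral_const_mul]
  have hInt : ∀ (a : ℝ) (k l : Fin m), Integrable (fun ξ : EuclideanSpace ℝ (Fin d) =>
      a * Real.cos (inner ℝ ξ (√(2 * r) • y k) - inner ℝ ξ (√(2 * r) • y l)))
      (ProbabilityTheory.stdGaussian (EuclideanSpace ℝ (Fin d))) := by
    intro a k l
    refine Integrable.const_mul ?_ a
    refine Integrable.of_bound (C := 1) (by fun_prop) (Eventually.of_forall fun ξ => ?_)
    exact Real.abs_cos_le_one _
  have hInt' : ∀ (b a : ℝ) (k l : Fin m), Integrable (fun ξ : EuclideanSpace ℝ (Fin d) =>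
      b * (a * Real.cos (inner ℝ ξ (√(2 * r) • y k) - inner ℝ ξ (√(2 * r) • y l))))
      (ProbabilityTheory.stdGaussian (EuclideanSpace ℝ (Fin d))) :=
    fun b a k l => (hInt a k l).const_mul b
  have hs : ∑ i, ∑ j, ∑ k, ∑ l, ∫ ξ, c i k * c j l * (γ i j *
        Real.cos (inner ℝ ξ (√(2 * r) • y k) - inner ℝ ξ (√(2 * r) • y l)))
        ∂(ProbabilityTheory.stdGaussian (EuclideanSpace ℝ (Fin d)))
      = ∫ ξ, ∑ i, ∑ j, ∑ k, ∑ l, c i k * c j l * (γ i j *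
        Real.cos (inner ℝ ξ (√(2 * r) • y k) - inner ℝ ξ (√(2 * r) • y l)))
        ∂(ProbabilityTheory.stdGaussian (EuclideanSpace ℝ (Fin d))) := by
    rw [integral_finsetSum _ fun i _ => integrable_finsetSum _ fun j _ =>
      integrable_finsetSum _ fun k _ => integrable_finsetSum _ fun l _ => hInt' _ _ k l]
    refine Finset.sum_congr rfl fun i _ => ?_
    rw [integral_finsetSum _ fun j _ =>
      integrable_finsetSum _ fun k _ => integrable_finsetSum _ fun l _ => hInt' _ _ k l]
    refine Finset.sum_congr rfl fun j _ => ?_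
    rw [integral_finsetSum _ fun k _ => integrable_finsetSum _ fun l _ => hInt' _ _ k l]
    refine Finset.sum_congr rfl fun k _ => ?_
    rw [integral_finsetSum _ fun l _ => hInt' _ _ k l]
  rw [hs]
  refine integral_nonpos fun ξ => ?_
  have hsum : ∀ F : Fin m → ℝ, ∑ i, ∑ k, c i k * F k = 0 := by
    intro F
    rw [Finset.sum_comm]
    simp [← Finset.sum_mul, hc]
  have h1 := hγ (fun i => ∑ k, c i k * Real.cos (inner ℝ ξ (√(2 * r) • y k))) (hsum _)
  have h2 := hγ (fun i => ∑ k, c i k * Real.sin (inner ℝ ξ (√(2 * r) • y k))) (hsum _)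
  refine le_trans (le_of_eq ?_) (add_nonpos h1 h2)
  simp only [← Finset.sum_add_distrib]
  refine Finset.sum_congr rfl fun i _ => Finset.sum_congr rfl fun j _ => ?_
  rw [Finset.sum_mul_sum, Finset.sum_mul_sum, Finset.sum_mul, Finset.sum_mul,
    ← Finset.sum_add_distrib]
  refine Finset.sum_congr rfl fun k _ => ?_
  rw [Finset.sum_mul, Finset.sum_mul, ← Finset.sum_add_distrib]
  refine Finset.sum_congr rfl fun l _ => ?_
  rw [Real.cos_sub]
  ring

/-- The tensor product of a conditionally negative definite matrix and the kernel `G8 r`. -/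
lemma sum_cnd_mul_G8_nonneg {n m d : ℕ} (γ : Fin n → Fin n → ℝ)
    (hγ : ∀ a : Fin n → ℝ, ∑ i, a i = 0 → ∑ i, ∑ j, a i * a j * γ i j ≤ 0)
    (c : Fin n → Fin m → ℝ) (hc : ∀ k, ∑ i, c i k = 0) (hc' : ∀ i, ∑ k, c i k = 0)
    (y : Fin m → EuclideanSpace ℝ (Fin d)) (r : NNReal) :
    0 ≤ ∑ i, ∑ j, ∑ k, ∑ l, c i k * c j l * (γ i j * G8 r ‖y k - y l‖) := by
  have hpos : ∀ r : NNReal, r ≠ 0 →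
      0 ≤ ∑ i, ∑ j, ∑ k, ∑ l, c i k * c j l * (γ i j * G8 r ‖y k - y l‖) := by
    intro r hr
    have h := sum_cnd_mul_gaussian_nonpos γ hγ c hc y r.2
    have e : ∑ i, ∑ j, ∑ k, ∑ l, c i k * c j l * (γ i j * G8 r ‖y k - y l‖)
        = -((1 + (r : ℝ)) / r) * ∑ i, ∑ j, ∑ k, ∑ l,
          c i k * c j l * (γ i j * Real.exp (-(r : ℝ) * ‖y k - y l‖ ^ 2)) := by
      rw [Finset.mul_sum]
      refine Finset.sum_congr rfl fun i _ => ?_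
      rw [Finset.mul_sum]
      refine Finset.sum_congr rfl fun j _ => ?_
      rw [Finset.mul_sum, ← sub_eq_zero, ← Finset.sum_sub_distrib]
      have : ∀ k, ∑ l, c i k * c j l * (γ i j * G8 r ‖y k - y l‖)
          - -((1 + (r : ℝ)) / r) * ∑ l,
            c i k * c j l * (γ i j * Real.exp (-(r : ℝ) * ‖y k - y l‖ ^ 2))
          = 0 := by
        intro k
        rw [Finset.mul_sum, ← Finset.sum_sub_distrib]
        calc _ = ∑ l, c i k * γ i j * ((1 + (r : ℝ)) / r) * c j l := by
              refine Finset.sum_congr rfl fun l _ => ?_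
              simp only [G8, hr, if_false]
              ring
          _ = 0 := by rw [← Finset.mul_sum, hc', mul_zero]
      simp only [this, Finset.sum_const_zero]
    rw [e]
    have : 0 ≤ (1 + (r : ℝ)) / r := by positivity
    exact mul_nonneg_of_nonpos_of_nonpos (neg_nonpos.2 this) h
  have hcont : Continuous fun r : NNReal =>
      ∑ i, ∑ j, ∑ k, ∑ l, c i k * c j l * (γ i j * G8 r ‖y k - y l‖) := by
    refine continuous_finsetSum _ fun i _ => continuous_finsetSum _ fun j _ =>
      continuous_finsetSum _ fun k _ => continuous_finsetSum _ fun l _ => ?_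
    exact continuous_const.mul (continuous_const.mul (continuous_G8 _))
  have hseq : Tendsto (fun N : ℕ => r + 1 / ((N : NNReal) + 1)) atTop (𝓝 r) := by
    simpa using tendsto_const_nhds.add (tendsto_one_div_add_atTop_nhds_zero_nat (𝕜 := NNReal))
  exact ge_of_tendsto' ((hcont.tendsto r).comp hseq) fun N => hpos _ (by positivity)

lemma integral_G8_simpleFunc (σ : Measure NNReal) [IsFiniteMeasure σ]
    (φ : SimpleFunc NNReal NNReal) (t : ℝ) :
    ∫ r, G8 (φ r) t ∂σ = ∑ v ∈ φ.range, (σ (φ ⁻¹' {v})).toReal * G8 v t := by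
  have e : ∀ r, G8 (φ r) t = ∑ v ∈ φ.range, (φ ⁻¹' {v}).indicator (fun _ => G8 v t) r := by
    intro r
    rw [Finset.sum_eq_single_of_mem (φ r) (φ.mem_range_self r)]
    · simp
    · intro v _ hv
      simp [Set.indicator, hv.symm]
  simp only [e]
  rw [integral_finsetSum]
  · refine Finset.sum_congr rfl fun v _ => ?_
    rw [integral_indicator_const _ (φ.measurableSet_preimage _), smul_eq_mul, Measure.real]
  · exact fun v _ => (integrable_const _).indicator (φ.measurableSet_preimage _)

/-- Mixtures of the kernels `G8 r` with conditionally negative definite weights are positive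
definite independent. -/
lemma isPDI_of_representation {X : Type*} (f : X → X → ℝ → ℝ) (σ : X → X → Measure NNReal)
    (hσ : ∀ u v, IsFiniteMeasure (σ u v))
    (hcnd : ∀ A : Set NNReal, MeasurableSet A → IsCND fun u v => ((σ u v) A).toReal)
    (hrep : ∀ (u v : X) (t : ℝ), 0 ≤ t → f u v t = ∫ r, G8 r t ∂(σ u v)) (d : ℕ) :
    IsPDI (fun p q : X × EuclideanSpace ℝ (Fin d) => f p.1 q.1 ‖p.2 - q.2‖) := by
  intro n m x y c hc hc'
  simp only [fun u v (z : EuclideanSpace ℝ (Fin d)) => hrep u v ‖z‖ (norm_nonneg z)]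
  let φ : ℕ → SimpleFunc NNReal NNReal := SimpleFunc.approxOn id measurable_id Set.univ 0
    (Set.mem_univ _)
  have hφ : ∀ r, Tendsto (fun N => φ N r) atTop (𝓝 r) := fun r =>
    SimpleFunc.tendsto_approxOn measurable_id (Set.mem_univ (0 : NNReal)) (x := r) (by simp)
  have hlim : ∀ (u v : X) (t : ℝ),
      Tendsto (fun N => ∫ r, G8 (φ N r) t ∂(σ u v)) atTop (𝓝 (∫ r, G8 r t ∂(σ u v))) := by
    intro u v t
    refine tendsto_integral_of_dominated_convergence (fun _ => t ^ 2 + 1) (fun N => ?_)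
      (integrable_const _) (fun N => Eventually.of_forall fun r => norm_G8_le _ t)
      (Eventually.of_forall fun r => ((continuous_G8 t).tendsto r).comp (hφ r))
    exact ((continuous_G8 t).measurable.comp (φ N).measurable).aestronglyMeasurable
  have hS : Tendsto (fun N => ∑ i, ∑ j, ∑ k, ∑ l,
      c i k * c j l * ∫ r, G8 (φ N r) ‖y k - y l‖ ∂(σ (x i) (x j))) atTop
      (𝓝 (∑ i, ∑ j, ∑ k, ∑ l, c i k * c j l * ∫ r, G8 r ‖y k - y l‖ ∂(σ (x i) (x j)))) :=
    tendsto_finsetSum _ fun i _ => tendsto_finsetSum _ fun j _ => tendsto_finsetSum _ fun k _ =>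
      tendsto_finsetSum _ fun l _ => (hlim _ _ _).const_mul _
  refine ge_of_tendsto' hS fun N => ?_
  have e : ∑ i, ∑ j, ∑ k, ∑ l, c i k * c j l * ∫ r, G8 (φ N r) ‖y k - y l‖ ∂(σ (x i) (x j))
      = ∑ v ∈ (φ N).range, ∑ i, ∑ j, ∑ k, ∑ l,
        c i k * c j l * ((σ (x i) (x j) (φ N ⁻¹' {v})).toReal * G8 v ‖y k - y l‖) := by
    simp only [integral_G8_simpleFunc, Finset.mul_sum]
    rw [Finset.sum_comm]
    rw [Finset.sum_comm]
    conv_rhs => rw [Finset.sum_comm]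
    refine Finset.sum_congr rfl fun i _ => ?_
    rw [Finset.sum_comm (s := (φ N).range)]
    refine Finset.sum_congr rfl fun j _ => ?_
    rw [Finset.sum_comm (s := (φ N).range)]
    refine Finset.sum_congr rfl fun k _ => ?_
    rw [Finset.sum_comm (s := (φ N).range)]
  rw [e]
  refine Finset.sum_nonneg fun v _ => ?_
  exact sum_cnd_mul_G8_nonneg (fun i j => (σ (x i) (x j) (φ N ⁻¹' {v})).toReal)
    (fun a ha => hcnd _ ((φ N).measurableSet_preimage _) n x a ha) c hc hc' y v

/-- The identity between integrals of `G8` determines real linear combinations of measures. -/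
lemma measureReal_eq_sum_of_integral_G8_eq {ι : Type*} (s : Finset ι) (a : ι → ℝ)
    (σ : ι → Measure NNReal) (τ : Measure NNReal) [∀ p, IsFiniteMeasure (σ p)] [IsFiniteMeasure τ]
    (h : ∀ t : ℝ, 0 ≤ t → ∫ r, G8 r t ∂τ = ∑ p ∈ s, a p * ∫ r, G8 r t ∂(σ p)) (A : Set NNReal) :
    τ.real A = ∑ p ∈ s, a p * (σ p).real A := by
  have hfin : ∀ b : ι → ℝ, IsFiniteMeasure (∑ p ∈ s, ENNReal.ofReal (b p) • σ p) := by
    intro b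
    have : ∀ p, IsFiniteMeasure (ENNReal.ofReal (b p) • σ p) := fun p =>
      Measure.smul_finite _ ENNReal.ofReal_ne_top
    infer_instance
  have hInt : ∀ (b : ι → ℝ) (t : ℝ), ∫ r, G8 r t ∂(∑ p ∈ s, ENNReal.ofReal (b p) • σ p)
      = ∑ p ∈ s, max (b p) 0 * ∫ r, G8 r t ∂(σ p) := by
    intro b t
    rw [integral_finsetSum_measure
      fun p _ => (integrable_G8 (σ p) t).smul_measure ENNReal.ofReal_ne_top]
    simp [integral_smul_measure, ENNReal.toReal_ofReal']
  have hreal : ∀ b : ι → ℝ, (∑ p ∈ s, ENNReal.ofReal (b p) • σ p).real A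
      = ∑ p ∈ s, max (b p) 0 * (σ p).real A := by
    intro b
    simp only [Measure.real, Measure.coe_finsetSum, Finset.sum_apply, Measure.smul_apply,
      smul_eq_mul]
    rw [ENNReal.toReal_sum fun p _ => ENNReal.mul_ne_top ENNReal.ofReal_ne_top (measure_ne_top _ _)]
    simp [ENNReal.toReal_ofReal']
  have hmax : ∀ b : ℝ, b = max b 0 - max (-b) 0 := fun b => (max_zero_sub_max_neg_zero_eq_self b).symm
  have := hfin a
  have := hfin fun p => -a p
  have key : τ + ∑ p ∈ s, ENNReal.ofReal (-a p) • σ p = ∑ p ∈ s, ENNReal.ofReal (a p) • σ p := by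
    refine measure_eq_of_integral_G8_eq _ _ fun t ht => ?_
    rw [integral_add_measure (integrable_G8 _ t) (integrable_G8 _ t), hInt a, hInt fun p => -a p,
      h t ht, ← Finset.sum_add_distrib]
    exact Finset.sum_congr rfl fun p _ => by rw [← add_mul]; congr 1; linarith [hmax (a p)]
  have hA := congrArg (fun ρ : Measure NNReal => ρ.real A) key
  beta_reduce at hA
  rw [measureReal_add_apply] at hA
  rw [hreal a, hreal fun p => -a p] at hA
  rw [eq_sub_of_add_eq hA, ← Finset.sum_sub_distrib]
  exact Finset.sum_congr rfl fun p _ => by rw [← sub_mul, ← hmax]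

/-- Contracting a positive definite independent kernel against weights of total mass zero gives a
function with a `G8` representation. -/
lemma exists_measure_G8_contraction {X : Type*} (f : X → X → ℝ → ℝ)
    (hf : ∀ u v, ContinuousOn (f u v) (Set.Ici 0))
    (hpdi : ∀ d : ℕ, IsPDI (fun p q : X × EuclideanSpace ℝ (Fin d) => f p.1 q.1 ‖p.2 - q.2‖))
    (h0 : ∀ u v : X, f u v 0 = 0) {n : ℕ} (x : Fin n → X) (c : Fin n → ℝ) (hc : ∑ i, c i = 0) :
    ∃ τ : Measure NNReal, IsFiniteMeasure τ ∧
      ∀ t : ℝ, 0 ≤ t → -∑ i, ∑ j, c i * c j * f (x i) (x j) t = ∫ r, G8 r t ∂τ := by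
  refine exists_measure_G8 (g := fun t => -∑ i, ∑ j, c i * c j * f (x i) (x j) t) ?_ (by simp [h0])
    ?_
  · exact (continuousOn_finsetSum _ fun i _ => continuousOn_finsetSum _ fun j _ =>
      continuousOn_const.mul (hf _ _)).neg
  · intro d m y b hb
    have h := hpdi d n m x y (fun i k => c i * b k) (fun k => by rw [← Finset.sum_mul, hc, zero_mul])
      (fun i => by rw [← Finset.mul_sum, hb, mul_zero])
    rw [← neg_nonneg]
    refine h.trans_eq ?_
    simp only [mul_neg, Finset.sum_neg_distrib, neg_neg, Finset.mul_sum]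
    rw [Finset.sum_congr rfl fun k _ => Finset.sum_comm, Finset.sum_comm]
    refine Finset.sum_congr rfl fun i _ => ?_
    rw [Finset.sum_congr rfl fun k _ => Finset.sum_comm, Finset.sum_comm]
    refine Finset.sum_congr rfl fun j _ => Finset.sum_congr rfl fun k _ =>
      Finset.sum_congr rfl fun l _ => ?_
    ring

end Auxiliary

/-- characterization of the kernels `f(u, v, ‖x - y‖)` that are PDI on
`X × ℝ^d` for every `d`, with zero projection kernels, by a measure-valued representation;
and uniqueness of the representation. -/
theorem stmt8 {X : Type*} [Nonempty X] (f : X → X → ℝ → ℝ)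
    (hf : ∀ u v, ContinuousOn (f u v) (Set.Ici 0))
    (hfsym : ∀ u v t, f u v t = f v u t) :
    ((∀ d : ℕ,
        IsPDI (fun p q : X × EuclideanSpace ℝ (Fin d) => f p.1 q.1 ‖p.2 - q.2‖) ∧
        (∀ (u : X) (x x' : EuclideanSpace ℝ (Fin d)), f u u ‖x - x'‖ = 0) ∧
        (∀ u v : X, f u v 0 = 0))
      ↔ ∃ σ : X → X → Measure NNReal,
          (∀ u v, IsFiniteMeasure (σ u v)) ∧
          (∀ u, σ u u = 0) ∧
          (∀ A : Set NNReal, MeasurableSet A →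
            IsCND fun u v => ((σ u v) A).toReal) ∧
          (∀ (u v : X) (t : ℝ), 0 ≤ t → f u v t = ∫ r, G8 r t ∂(σ u v))) ∧
    (∀ σ σ' : X → X → Measure NNReal,
      (∀ u v, IsFiniteMeasure (σ u v)) → (∀ u v, IsFiniteMeasure (σ' u v)) →
      (∀ (u v : X) (t : ℝ), 0 ≤ t → f u v t = ∫ r, G8 r t ∂(σ u v)) →
      (∀ (u v : X) (t : ℝ), 0 ≤ t → f u v t = ∫ r, G8 r t ∂(σ' u v)) →
      σ = σ') := by
  refine ⟨⟨fun H => ?_, fun ⟨σ, hσ, hdiag, hcnd, hrep⟩ d => ⟨?_, fun u x x' => ?_, fun u v => ?_⟩⟩,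
    fun σ σ' hσ hσ' h h' => ?_⟩
  · have hpdi := fun d => (H d).1
    have h0 : ∀ u v : X, f u v 0 = 0 := (H 0).2.2
    have hdiag : ∀ (u : X) (t : ℝ), 0 ≤ t → f u u t = 0 := by
      intro u t ht
      simpa [abs_of_nonneg ht] using (H 1).2.1 u (EuclideanSpace.single 0 t) 0
    have hex : ∀ u v : X, ∃ σ : Measure NNReal, IsFiniteMeasure σ ∧
        ∀ t : ℝ, 0 ≤ t → f u v t = ∫ r, G8 r t ∂σ := by
      intro u v
      obtain ⟨τ, hτ, h⟩ := exists_measure_G8_contraction f hf hpdi h0 ![u, v] ![1, -1] (by simp)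
      refine ⟨ENNReal.ofReal (1 / 2) • τ, Measure.smul_finite _ ENNReal.ofReal_ne_top,
        fun t ht => ?_⟩
      rw [integral_smul_measure, ← h t ht, ENNReal.toReal_ofReal (by norm_num)]
      simp [Fin.sum_univ_two, hdiag u t ht, hdiag v t ht, hfsym v u t]
      ring
    choose σ hσ hrep using hex
    refine ⟨σ, hσ, fun u => ?_, fun A _ n x c hc => ?_, hrep⟩
    · exact measure_eq_of_integral_G8_eq _ _ fun t ht => by
        rw [← hrep u u t ht, hdiag u t ht, integral_zero_measure]
    · obtain ⟨τ, hτ, h⟩ := exists_measure_G8_contraction f hf hpdi h0 x c hc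
      have hA := measureReal_eq_sum_of_integral_G8_eq Finset.univ
        (fun p : Fin n × Fin n => -(c p.1 * c p.2)) (fun p => σ (x p.1) (x p.2)) τ
        (fun t ht => by
          rw [← h t ht, Fintype.sum_prod_type]
          simp only [neg_mul, Finset.sum_neg_distrib, hrep _ _ t ht]) A
      rw [Fintype.sum_prod_type] at hA
      simp only [neg_mul, Finset.sum_neg_distrib] at hA
      have := measureReal_nonneg (μ := τ) (s := A)
      rw [hA] at this
      exact neg_nonneg.1 this
  · exact isPDI_of_representation f σ hσ hcnd hrep d
  · rw [hrep u u _ (norm_nonneg _), hdiag, integral_zero_measure]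
  · rw [hrep u v 0 le_rfl]
    simp [G8]
  · funext u v
    exact measure_eq_of_integral_G8_eq _ _ fun t ht => by rw [← h u v t ht, h' u v t ht]
end
end
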